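/- For the metric g determined by the real constants a, b, p, q, s, the following are equivalent: (i) g is Einstein, i.e. there exists a real constant c with ρ_{ij} = c·g_{ij} at every point; (ii) g is Ricci flat, i.e. ρ_{ij} = 0 at every point; (iii) b = −a and s = −p. -/

import Mathlib

noncomputable section

open scoped BigOperators

/-- The metric of a four-dimensional two-symmetric Lorentzian manifold, in
coordinates `x 0 = x¹, x 1 = x², x 2 = x³, x 3 = x⁴`:
`g₁₄ = g₄₁ = g₂₂ = g₃₃ = 1`,
`g₄₄ = x⁴(a(x²)² + b(x³)²) + p(x²)² + 2q x²x³ + s(x³)²`, all others zero. -/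
def gmat (a b p q s : ℝ) (x : Fin 4 → ℝ) : Matrix (Fin 4) (Fin 4) ℝ :=
  Matrix.of fun i j =>
    if i = 0 ∧ j = 3 then 1
    else if i = 3 ∧ j = 0 then 1
    else if i = 1 ∧ j = 1 then 1
    else if i = 2 ∧ j = 2 then 1
    else if i = 3 ∧ j = 3 then
      x 3 * (a * (x 1) ^ 2 + b * (x 2) ^ 2) + p * (x 1) ^ 2
        + 2 * q * x 1 * x 2 + s * (x 2) ^ 2
    else 0

/-- The inverse matrix `g^{ij}`. -/
def ginv (a b p q s : ℝ) (x : Fin 4 → ℝ) : Matrix (Fin 4) (Fin 4) ℝ :=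
  (gmat a b p q s x)⁻¹

/-- Partial derivative `∂_i` of a function on ℝ⁴. -/
def pd (i : Fin 4) (f : (Fin 4 → ℝ) → ℝ) (x : Fin 4 → ℝ) : ℝ :=
  fderiv ℝ f x (Pi.single i 1)

/-- Christoffel symbols `Γ^k_{ij} = (1/2) Σ_l g^{kl}(∂_i g_{jl} + ∂_j g_{il} − ∂_l g_{ij})`. -/
def Gam (a b p q s : ℝ) (k i j : Fin 4) (x : Fin 4 → ℝ) : ℝ :=
  (1 / 2) * ∑ l, ginv a b p q s x k l *
    (pd i (fun y => gmat a b p q s y j l) x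
      + pd j (fun y => gmat a b p q s y i l) x
      - pd l (fun y => gmat a b p q s y i j) x)

/-- Curvature tensor
`R^i_{jkl} = ∂_k Γ^i_{lj} − ∂_l Γ^i_{kj} + Σ_m (Γ^i_{km} Γ^m_{lj} − Γ^i_{lm} Γ^m_{kj})`. -/
def Riem (a b p q s : ℝ) (i j k l : Fin 4) (x : Fin 4 → ℝ) : ℝ :=
  pd k (Gam a b p q s i l j) x - pd l (Gam a b p q s i k j) x
    + ∑ m, (Gam a b p q s i k m x * Gam a b p q s m l j x
      - Gam a b p q s i l m x * Gam a b p q s m k j x)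

/-- Ricci tensor `ρ_{jl} = Σ_i R^i_{jil}`. -/
def Ric (a b p q s : ℝ) (j l : Fin 4) (x : Fin 4 → ℝ) : ℝ :=
  ∑ i, Riem a b p q s i j i l x

section PartialDerivatives

variable {f g : (Fin 4 → ℝ) → ℝ} {x : Fin 4 → ℝ} (i : Fin 4)

theorem pd_const (c : ℝ) (x : Fin 4 → ℝ) : pd i (fun _ => c) x = 0 := by
  simp [pd]

theorem pd_coord (j : Fin 4) (x : Fin 4 → ℝ) :
    pd i (fun y => y j) x = if j = i then 1 else 0 := by
  simp [pd, (hasFDerivAt_apply (𝕜 := ℝ) j x).fderiv, Pi.single_apply]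

theorem pd_add (hf : DifferentiableAt ℝ f x) (hg : DifferentiableAt ℝ g x) :
    pd i (fun y => f y + g y) x = pd i f x + pd i g x := by
  simp [pd, fderiv_fun_add hf hg]

theorem pd_mul (hf : DifferentiableAt ℝ f x) (hg : DifferentiableAt ℝ g x) :
    pd i (fun y => f y * g y) x = f x * pd i g x + g x * pd i f x := by
  simp [pd, fderiv_fun_mul hf hg]

end PartialDerivatives

/-- The gradient of the component `g₄₄` of the metric. -/
def gradH (a b p q s : ℝ) (i : Fin 4) (x : Fin 4 → ℝ) : ℝ :=
  if i = 1 then 2 * (a * (x 3 * x 1) + p * x 1 + q * x 2)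
  else if i = 2 then 2 * (b * (x 3 * x 2) + q * x 1 + s * x 2)
  else if i = 3 then a * (x 1 * x 1) + b * (x 2 * x 2)
  else 0

theorem pd_gmat (a b p q s : ℝ) (i j l : Fin 4) (x : Fin 4 → ℝ) :
    pd i (fun y => gmat a b p q s y j l) x =
      if j = 3 ∧ l = 3 then gradH a b p q s i x else 0 := by
  by_cases h : j = 3 ∧ l = 3
  · obtain ⟨rfl, rfl⟩ := h
    simp only [gmat, Matrix.of_apply, Fin.reduceEq, and_true, and_false, if_false,
      if_true, pow_two]
    simp (disch := fun_prop) only [pd_add, pd_mul, pd_const, pd_coord]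
    fin_cases i <;> simp [gradH] <;> ring
  · have hconst : (fun y => gmat a b p q s y j l) = fun _ => gmat a b p q s 0 j l := by
      funext y
      simp only [gmat, Matrix.of_apply, if_neg h]
    rw [hconst, pd_const, if_neg h]

theorem ginv_eq (a b p q s : ℝ) (x : Fin 4 → ℝ) :
    ginv a b p q s x =
      !![-gmat a b p q s x 3 3, 0, 0, 1; 0, 1, 0, 0; 0, 0, 1, 0; 1, 0, 0, 0] := by
  apply Matrix.inv_eq_right_inv
  ext i j
  fin_cases i <;> fin_cases j <;> simp [Matrix.mul_apply, Fin.sum_univ_four, gmat]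
  ring

theorem Gam_eq (a b p q s : ℝ) (k i j : Fin 4) :
    Gam a b p q s k i j = fun x =>
      if k = 0 then
        if j = 3 then (1 / 2) * gradH a b p q s i x
        else if i = 3 then (1 / 2) * gradH a b p q s j x
        else 0
      else if k ≠ 3 ∧ i = 3 ∧ j = 3 then (-1 / 2) * gradH a b p q s k x
      else 0 := by
  funext x
  simp only [Gam, ginv_eq, pd_gmat, Fin.sum_univ_four]
  fin_cases k <;> fin_cases i <;> fin_cases j <;> simp [gradH] <;> ring

theorem Ric_eq (a b p q s : ℝ) (j l : Fin 4) (x : Fin 4 → ℝ) :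
    Ric a b p q s j l x =
      if j = 3 ∧ l = 3 then -((a + b) * x 3 + (p + s)) else 0 := by
  simp only [Ric, Riem, Gam_eq, Fin.sum_univ_four]
  fin_cases j <;> fin_cases l <;>
    simp (disch := fun_prop) [gradH, pd_add, pd_mul, pd_const, pd_coord]
  ring

/-- `g` is Einstein iff it is Ricci flat iff `b = −a` and `s = −p`. -/
theorem einstein_iff_ricci_flat (a b p q s : ℝ) :
    ((∃ c : ℝ, ∀ (x : Fin 4 → ℝ) (i j : Fin 4),
        Ric a b p q s i j x = c * gmat a b p q s x i j) ↔ (b = -a ∧ s = -p)) ∧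
    ((∀ (x : Fin 4 → ℝ) (i j : Fin 4), Ric a b p q s i j x = 0) ↔ (b = -a ∧ s = -p)) := by
  have hflat : b = -a ∧ s = -p → ∀ (x : Fin 4 → ℝ) (i j : Fin 4), Ric a b p q s i j x = 0 := by
    rintro ⟨rfl, rfl⟩ x i j
    simp [Ric_eq]
  have heinstein : (∃ c : ℝ, ∀ (x : Fin 4 → ℝ) (i j : Fin 4),
      Ric a b p q s i j x = c * gmat a b p q s x i j) → b = -a ∧ s = -p := by
    rintro ⟨c, hc⟩
    have hc0 : c = 0 := by simpa [Ric_eq, gmat] using (hc 0 1 1).symm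
    have h0 := hc 0 3 3
    have h1 := hc (Pi.single 3 1) 3 3
    simp only [Ric_eq, hc0, and_self, if_true, zero_mul, Pi.zero_apply, Pi.single_eq_same] at h0 h1
    constructor <;> linarith
  exact ⟨⟨heinstein, fun h => ⟨0, by simpa using hflat h⟩⟩,
    ⟨fun h => heinstein ⟨0, by simpa using h⟩, hflat⟩⟩
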